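/- Let α > 0, ω > 0, and 0 < τ < ν < π/2. Then shifting the contour upward by iν crosses the simple pole at t = iτ (whose residue equals e^{−αω cos(ν−τ)}), giving (1/(2πi)) ∫_{−∞}^{∞} e^{−α ω cosh(t − iν)} sinh(t) / (cosh t − cos τ) dt = e^{−α ω cos(ν − τ)} − (1/(2πi)) ∫_{−∞}^{∞} e^{−α ω cosh s} sinh(s + iν) / (cos τ − cosh(s + iν)) ds. -/

import Mathlib

namespace Stmt3Aux

open Complex MeasureTheory Filter Topology Set

lemma cosh_eq (x y : ℝ) : Complex.cosh ((x : ℂ) + y * I) =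
    ((Real.cosh x * Real.cos y : ℝ) : ℂ) + ((Real.sinh x * Real.sin y : ℝ) : ℂ) * I := by
  rw [Complex.cosh_add, Complex.cosh_mul_I, Complex.sinh_mul_I]
  push_cast
  ring

lemma sinh_eq (x y : ℝ) : Complex.sinh ((x : ℂ) + y * I) =
    ((Real.sinh x * Real.cos y : ℝ) : ℂ) + ((Real.cosh x * Real.sin y : ℝ) : ℂ) * I := by
  rw [Complex.sinh_add, Complex.cosh_mul_I, Complex.sinh_mul_I]
  push_cast
  ring

lemma norm_sinh_le (x y : ℝ) : ‖Complex.sinh ((x : ℂ) + y * I)‖ ≤ Real.cosh x := by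
  rw [sinh_eq, Complex.norm_add_mul_I]
  apply Real.sqrt_le_iff.2 ⟨(Real.cosh_pos x).le, ?_⟩
  have h1 := Real.cosh_sq x
  have h2 := Real.sin_sq_add_cos_sq y
  have h3 := sq_nonneg (Real.cos y)
  nlinarith

lemma le_norm_cosh (x y : ℝ) : |Real.sinh x| ≤ ‖Complex.cosh ((x : ℂ) + y * I)‖ := by
  rw [cosh_eq, Complex.norm_add_mul_I]
  apply Real.le_sqrt_of_sq_le
  rw [sq_abs]
  have h1 := Real.cosh_sq x
  have h2 := Real.sin_sq_add_cos_sq y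
  have h3 := sq_nonneg (Real.cos y)
  nlinarith

lemma abs_le_abs_sinh (x : ℝ) : |x| ≤ |Real.sinh x| := by
  rw [Real.abs_sinh]
  exact Real.self_le_sinh_iff.2 (abs_nonneg x)

lemma sq_le_cosh (x : ℝ) : x ^ 2 / 2 ≤ Real.cosh x := by
  have h := Real.cosh_two_mul (x / 2)
  have h2 := Real.cosh_sq (x / 2)
  have h3 := sq_le_sq.2 (abs_le_abs_sinh (x / 2))
  rw [show 2 * (x / 2) = x by ring] at h
  nlinarith

/-- The integrand. -/
noncomputable def F (a ν τ : ℝ) (z : ℂ) : ℂ :=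
  Complex.exp (-(a : ℂ) * Complex.cosh (z - I * ν)) * Complex.sinh z /
    (Complex.cosh z - (Real.cos τ : ℂ))

lemma norm_F_le {a ν τ : ℝ} (ha : 0 < a) (hν : ν < Real.pi / 2) {x y : ℝ}
    (hx : 2 ≤ |x|) (hy0 : 0 ≤ y) (hy : y ≤ ν) :
    ‖F a ν τ (x + y * I)‖ ≤ 3 * Real.exp (-(a * Real.cos ν / 2) * x ^ 2) := by
  have hcos : 0 < Real.cos ν := Real.cos_pos_of_mem_Ioo ⟨by linarith [Real.pi_pos], hν⟩
  have hcos2 : Real.cos ν ≤ Real.cos (y - ν) := by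
    rw [← Real.cos_neg (y - ν)]
    apply Real.cos_le_cos_of_nonneg_of_le_pi <;> linarith [Real.pi_pos]
  have e1 : ‖Complex.exp (-(a : ℂ) * Complex.cosh ((x : ℂ) + y * I - I * ν))‖ ≤
      Real.exp (-(a * Real.cos ν / 2) * x ^ 2) := by
    rw [show (x : ℂ) + y * I - I * ν = (x : ℂ) + ((y - ν : ℝ) : ℂ) * I by push_cast; ring,
      cosh_eq, Complex.norm_exp]
    apply Real.exp_le_exp.2
    have : (-(a : ℂ) * (((Real.cosh x * Real.cos (y - ν) : ℝ) : ℂ) +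
        ((Real.sinh x * Real.sin (y - ν) : ℝ) : ℂ) * I)).re =
        -(a * (Real.cosh x * Real.cos (y - ν))) := by
      rw [← Complex.ofReal_neg, Complex.re_ofReal_mul]
      simp [-Complex.ofReal_mul]
    rw [this]
    have h1 : x ^ 2 / 2 * Real.cos ν ≤ Real.cosh x * Real.cos (y - ν) :=
      mul_le_mul (sq_le_cosh x) hcos2 hcos.le (Real.cosh_pos x).le
    nlinarith
  have hs := abs_le_abs_sinh x
  have e2 : Real.cosh x ≤ |Real.sinh x| + 1 := by
    have := Real.cosh_sq x
    rw [← sq_abs (Real.sinh x)] at this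
    apply le_of_sq_le_sq _ (by positivity)
    nlinarith [abs_nonneg (Real.sinh x)]
  have e3 : |Real.sinh x| - 1 ≤ ‖Complex.cosh ((x : ℂ) + y * I) - (Real.cos τ : ℂ)‖ := by
    have h1 := norm_sub_norm_le (Complex.cosh ((x : ℂ) + y * I)) (Real.cos τ : ℂ)
    have h2 := le_norm_cosh x y
    have h3 : ‖(Real.cos τ : ℂ)‖ ≤ 1 := by
      rw [Complex.norm_real]; exact Real.abs_cos_le_one τ
    linarith
  have e4 := norm_sinh_le x y
  unfold F
  rw [norm_div, norm_mul, div_le_iff₀ (by linarith)]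
  calc _ ≤ Real.exp (-(a * Real.cos ν / 2) * x ^ 2) * (|Real.sinh x| + 1) :=
        mul_le_mul e1 (e4.trans e2) (norm_nonneg _) (Real.exp_pos _).le
    _ ≤ _ := by
        have := Real.exp_pos (-(a * Real.cos ν / 2) * x ^ 2)
        nlinarith

lemma cosh_ne {τ x y ν : ℝ} (hτ : 0 < τ) (hτν : τ < ν) (hν : ν < Real.pi / 2)
    (hy0 : 0 ≤ y) (hy : y ≤ ν) (hne : ¬ (x = 0 ∧ y = τ)) :
    Complex.cosh ((x : ℂ) + y * I) - (Real.cos τ : ℂ) ≠ 0 := by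
  intro h
  rw [cosh_eq] at h
  have hre := congrArg Complex.re h
  have him := congrArg Complex.im h
  simp only [Complex.sub_re, Complex.add_re, Complex.ofReal_re, Complex.re_ofReal_mul, Complex.I_re,
    Complex.sub_im, Complex.add_im, Complex.ofReal_im, Complex.im_ofReal_mul, Complex.I_im,
    Complex.zero_re, Complex.zero_im] at hre him
  have hpi := Real.pi_pos
  have him' : Real.sinh x * Real.sin y = 0 := by linarith
  rcases mul_eq_zero.1 him' with h1 | h1
  · have hx : x = 0 := Real.sinh_eq_zero.1 h1
    subst hx
    apply hne
    refine ⟨rfl, Real.injOn_cos ⟨hy0, by linarith⟩ ⟨hτ.le, by linarith⟩ ?_⟩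
    simp at hre
    linarith
  · have hy1 : y = 0 := by
      by_contra hc
      have := Real.sin_pos_of_pos_of_lt_pi (lt_of_le_of_ne hy0 (Ne.symm hc)) (by linarith)
      linarith
    subst hy1
    have h2 : Real.cos τ < Real.cos 0 :=
      Real.cos_lt_cos_of_nonneg_of_le_pi le_rfl (by linarith) hτ
    have h3 := Real.one_le_cosh x
    simp at hre h2
    linarith

lemma integrable_F {a ν τ y : ℝ} (ha : 0 < a) (hτ : 0 < τ) (hτν : τ < ν) (hν : ν < Real.pi / 2)
    (hy0 : 0 ≤ y) (hy : y ≤ ν) (hne : y ≠ τ) :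
    Integrable (fun x : ℝ => F a ν τ (x + y * I)) := by
  have hc : Continuous (fun x : ℝ => F a ν τ (x + y * I)) := by
    unfold F
    refine Continuous.div ?_ ?_ (fun x => cosh_ne hτ hτν hν hy0 hy (fun h => hne h.2))
    · exact (Complex.continuous_exp.comp (continuous_const.mul
        (Complex.continuous_cosh.comp (by fun_prop)))).mul
        (Complex.continuous_sinh.comp (by fun_prop))
    · exact (Complex.continuous_cosh.comp (by fun_prop)).sub continuous_const
  have hcos : 0 < Real.cos ν := Real.cos_pos_of_mem_Ioo ⟨by linarith [Real.pi_pos], hν⟩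
  have hg := integrable_exp_neg_mul_sq (b := a * Real.cos ν / 2) (by positivity)
  have key : ∀ x : ℝ, 2 ≤ |x| → ‖F a ν τ (x + y * I)‖ ≤
      3 * ‖Real.exp (-(a * Real.cos ν / 2) * x ^ 2)‖ := by
    intro x hx
    rw [Real.norm_of_nonneg (Real.exp_pos _).le]
    exact norm_F_le ha hν hx hy0 hy
  refine hc.locallyIntegrable.integrable_of_isBigO_atBot_atTop
    (Asymptotics.IsBigO.of_bound 3 ?_) (hg.integrableAtFilter _)
    (Asymptotics.IsBigO.of_bound 3 ?_) (hg.integrableAtFilter _)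
  · filter_upwards [eventually_le_atBot (-2 : ℝ)] with x hx
    exact key x (by rw [abs_of_neg (by linarith)]; linarith)
  · filter_upwards [eventually_ge_atTop (2 : ℝ)] with x hx
    exact key x (by rw [abs_of_pos (by linarith)]; linarith)

lemma integral_inv (d R : ℝ) (hd : d ≠ 0) :
    ∫ x in (-R)..R, ((x : ℂ) - d * I)⁻¹ = 2 * I * (Real.arctan (R / d) : ℂ) := by
  have hpos : ∀ x : ℝ, 0 < x ^ 2 + d ^ 2 := fun x => by positivity
  have hne : ∀ x : ℝ, (x : ℂ) - d * I ≠ 0 := by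
    intro x h
    have := congrArg Complex.im h
    simp at this
    exact hd this
  have hder : ∀ x : ℝ, HasDerivAt (fun x : ℝ =>
      ((Real.log (x ^ 2 + d ^ 2) / 2 : ℝ) : ℂ) + ((Real.arctan (x / d) : ℝ) : ℂ) * I)
      (((x : ℂ) - d * I)⁻¹) x := by
    intro x
    have h1 : HasDerivAt (fun x : ℝ => Real.log (x ^ 2 + d ^ 2) / 2)
        ((2 * x) / (x ^ 2 + d ^ 2) / 2) x := by
      have : HasDerivAt (fun x : ℝ => x ^ 2 + d ^ 2) (2 * x) x := by
        simpa using (hasDerivAt_pow 2 x).add_const (d ^ 2)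
      exact (this.log (hpos x).ne').div_const 2
    have h2 : HasDerivAt (fun x : ℝ => Real.arctan (x / d)) (1 / (1 + (x / d) ^ 2) * (1 / d)) x :=
      ((hasDerivAt_id x).div_const d).arctan
    have h3 := h1.ofReal_comp.add (h2.ofReal_comp.mul_const I)
    refine h3.congr_deriv ?_
    symm
    have hq : ((x : ℂ) ^ 2 + d ^ 2) ≠ 0 := by exact_mod_cast (hpos x).ne'
    have hd' : (d : ℂ) ≠ 0 := by exact_mod_cast hd
    have e2 : (1 / (1 + (x / d) ^ 2) * (1 / d) : ℝ) = d / (x ^ 2 + d ^ 2) := by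
      have := (hpos x).ne'
      have h4 : d ^ 2 + x ^ 2 ≠ 0 := by rw [add_comm]; exact this
      field_simp
      ring
    rw [e2]
    rw [← mul_right_inj' (hne x), mul_inv_cancel₀ (hne x)]
    push_cast
    field_simp
    ring_nf
    rw [Complex.I_sq]
    ring
  rw [intervalIntegral.integral_eq_sub_of_hasDerivAt (fun x _ => hder x)]
  · rw [neg_div, Real.arctan_neg]
    push_cast
    rw [neg_sq]
    ring
  · apply Continuous.intervalIntegrable
    exact Continuous.inv₀ (by fun_prop) hne

/-- Regularized integrand. -/
noncomputable def h (a ν τ : ℝ) (z : ℂ) : ℂ :=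
  Complex.exp (-(a : ℂ) * Complex.cosh (z - I * ν)) * Complex.sinh z /
    dslope Complex.cosh (τ * I) z

lemma cosh_tau (τ : ℝ) : Complex.cosh (τ * I) = (Real.cos τ : ℂ) := by
  rw [Complex.cosh_mul_I, Complex.ofReal_cos]

lemma sinh_tau_ne {τ : ℝ} (hτ : 0 < τ) (hτ' : τ < Real.pi) : Complex.sinh (τ * I) ≠ 0 := by
  rw [Complex.sinh_mul_I, ← Complex.ofReal_sin]
  exact mul_ne_zero (by exact_mod_cast (Real.sin_pos_of_pos_of_lt_pi hτ hτ').ne') I_ne_zero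

lemma h_tau {a ν τ : ℝ} (hτ : 0 < τ) (hτ' : τ < Real.pi) :
    h a ν τ (τ * I) = (Real.exp (-a * Real.cos (ν - τ)) : ℂ) := by
  unfold h
  rw [dslope_same, Complex.deriv_cosh, mul_div_cancel_right₀ _ (sinh_tau_ne hτ hτ'),
    show (τ : ℂ) * I - I * ν = -(((ν - τ : ℝ) : ℂ) * I) by push_cast; ring,
    Complex.cosh_neg, Complex.cosh_mul_I]
  push_cast
  rfl

lemma dslope_h_eq {a ν τ : ℝ} {z : ℂ} (hz : z ≠ τ * I) :
    dslope (h a ν τ) (τ * I) z = F a ν τ z - h a ν τ (τ * I) * (z - τ * I)⁻¹ := by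
  have hz' : z - τ * I ≠ 0 := sub_ne_zero.2 hz
  rw [dslope_of_ne _ hz, slope_def_field, sub_div]
  congr 1
  unfold h F
  rw [dslope_of_ne _ hz, slope_def_field, cosh_tau]
  rw [div_div, div_mul_cancel₀ _ hz']

lemma diff_G {a ν τ R : ℝ} (hτ : 0 < τ) (hτν : τ < ν) (hν : ν < Real.pi / 2) :
    DifferentiableOn ℂ (dslope (h a ν τ) (τ * I)) (Set.uIcc (-R) R ×ℂ Set.uIcc 0 ν) := by
  have hpi := Real.pi_pos
  have hq : Differentiable ℂ (dslope Complex.cosh (τ * I)) := by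
    rw [← differentiableOn_univ, Complex.differentiableOn_dslope univ_mem]
    exact Complex.differentiable_cosh.differentiableOn
  set U : Set ℂ := {z | dslope Complex.cosh (τ * I) z ≠ 0} with hU
  have hUo : IsOpen U := isOpen_ne_fun hq.continuous continuous_const
  have hmem : (τ * I : ℂ) ∈ U := by
    rw [hU, mem_ofPred_eq, dslope_same, Complex.deriv_cosh]
    exact sinh_tau_ne hτ (by linarith)
  have hh : DifferentiableOn ℂ (h a ν τ) U := by
    unfold h
    refine DifferentiableOn.div ?_ hq.differentiableOn (fun z hz => hz)
    apply Differentiable.differentiableOn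
    exact (Complex.differentiable_exp.comp ((Complex.differentiable_cosh.comp
      (differentiable_id.sub_const _)).const_mul _)).mul Complex.differentiable_sinh
  refine ((Complex.differentiableOn_dslope (hUo.mem_nhds hmem)).2 hh).mono ?_
  intro z hz
  by_cases hzt : z = τ * I
  · rw [hzt]; exact hmem
  have hz2 := hz.2
  rw [mem_preimage, uIcc_of_le (by linarith)] at hz2
  rw [hU, mem_ofPred_eq, dslope_of_ne _ hzt, slope_def_field, cosh_tau]
  refine div_ne_zero ?_ (sub_ne_zero.2 hzt)
  have := cosh_ne (x := z.re) (y := z.im) hτ hτν hν hz2.1 hz2.2 (by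
    rintro ⟨h1, h2⟩
    apply hzt
    apply Complex.ext <;> simp [h1, h2])
  rwa [Complex.re_add_im] at this

lemma side_bound {a ν τ x : ℝ} (ha : 0 < a) (hτ : 0 < τ) (hτν : τ < ν) (hν : ν < Real.pi / 2)
    (hx : 2 ≤ |x|) :
    ‖∫ y in (0:ℝ)..ν, dslope (h a ν τ) (τ * I) (x + y * I)‖ ≤
      (3 * Real.exp (-(a * Real.cos ν / 2) * x ^ 2) + ‖h a ν τ (τ * I)‖ * |x|⁻¹) * |ν - 0| := by
  apply intervalIntegral.norm_integral_le_of_norm_le_const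
  intro y hy
  rw [uIoc_of_le (by linarith)] at hy
  have hxr : ((x : ℂ) + y * I - τ * I).re = x := by simp
  have hne : (x : ℂ) + y * I ≠ τ * I := by
    intro hc
    rw [hc, sub_self, zero_re] at hxr
    rw [← hxr] at hx
    norm_num at hx
  rw [dslope_h_eq hne]
  refine (norm_sub_le _ _).trans (add_le_add (norm_F_le ha hν hx hy.1.le hy.2) ?_)
  rw [norm_mul, norm_inv]
  gcongr
  calc |x| = |((x : ℂ) + y * I - τ * I).re| := by rw [hxr]
    _ ≤ _ := Complex.abs_re_le_norm _

lemma tendsto_bound {a ν C : ℝ} (hb : 0 < a * Real.cos ν / 2) :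
    Tendsto (fun R : ℝ => (3 * Real.exp (-(a * Real.cos ν / 2) * R ^ 2) + C * |R|⁻¹) * |ν - 0|)
      atTop (𝓝 0) := by
  have h1 : Tendsto (fun R : ℝ => Real.exp (-(a * Real.cos ν / 2) * R ^ 2)) atTop (𝓝 0) :=
    Real.tendsto_exp_atBot.comp
      ((tendsto_pow_atTop two_ne_zero).const_mul_atTop_of_neg (by linarith))
  have h2 : Tendsto (fun R : ℝ => |R|⁻¹) atTop (𝓝 0) :=
    tendsto_inv_atTop_zero.comp tendsto_abs_atTop_atTop
  simpa using ((h1.const_mul 3).add (h2.const_mul C)).mul_const |ν - 0|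

lemma line_integral {a ν τ y R : ℝ} (ha : 0 < a) (hτ : 0 < τ) (hτν : τ < ν)
    (hν : ν < Real.pi / 2) (hy0 : 0 ≤ y) (hy : y ≤ ν) (hne : y ≠ τ) :
    ∫ x in (-R)..R, dslope (h a ν τ) (τ * I) (x + y * I) =
      (∫ x in (-R)..R, F a ν τ (x + y * I)) -
        h a ν τ (τ * I) * (2 * I * (Real.arctan (R / (τ - y)) : ℂ)) := by
  have hd : τ - y ≠ 0 := sub_ne_zero.2 hne.symm
  rw [← integral_inv (τ - y) R hd, ← intervalIntegral.integral_const_mul,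
    ← intervalIntegral.integral_sub]
  · apply intervalIntegral.integral_congr
    intro x _
    have : (x : ℂ) + y * I ≠ τ * I := by
      intro hc
      have := congrArg Complex.im hc
      simp at this
      exact hne this
    simp only []
    rw [dslope_h_eq this]
    congr 3
    push_cast
    ring
  · exact (integrable_F ha hτ hτν hν hy0 hy hne).intervalIntegrable
  · apply Continuous.intervalIntegrable
    refine continuous_const.mul (Continuous.inv₀ (by fun_prop) ?_)
    intro x hc
    have := congrArg Complex.im hc
    simp at this
    apply hd
    linarith

lemma main {a ν τ : ℝ} (ha : 0 < a) (hτ : 0 < τ) (hτν : τ < ν) (hν : ν < Real.pi / 2) :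
    (∫ x : ℝ, F a ν τ (x + (0 : ℝ) * I)) - (∫ x : ℝ, F a ν τ (x + ν * I)) =
      2 * Real.pi * I * h a ν τ (τ * I) := by
  have hν0 : 0 < ν := hτ.trans hτν
  have hcos : 0 < Real.cos ν := Real.cos_pos_of_mem_Ioo ⟨by linarith [Real.pi_pos], hν⟩
  have hbd := tendsto_bound (a := a) (ν := ν) (C := ‖h a ν τ (τ * I)‖) (by positivity)
  have s1 : Tendsto (fun R : ℝ => ∫ y in (0:ℝ)..ν, dslope (h a ν τ) (τ * I) (R + y * I))
      atTop (𝓝 0) := by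
    apply squeeze_zero_norm' _ hbd
    filter_upwards [eventually_ge_atTop (2 : ℝ)] with R hR
    exact side_bound ha hτ hτν hν (hR.trans (le_abs_self R))
  have s2 : Tendsto (fun R : ℝ => ∫ y in (0:ℝ)..ν, dslope (h a ν τ) (τ * I) ((-R : ℝ) + y * I))
      atTop (𝓝 0) := by
    apply squeeze_zero_norm' _ hbd
    filter_upwards [eventually_ge_atTop (2 : ℝ)] with R hR
    have := side_bound (x := -R) ha hτ hτν hν (by rw [abs_neg]; exact hR.trans (le_abs_self R))
    rwa [neg_sq, abs_neg] at this
  have i1 := intervalIntegral_tendsto_integral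
    (integrable_F ha hτ hτν hν le_rfl hν0.le hτ.ne) tendsto_neg_atTop_atBot tendsto_id
  have i2 := intervalIntegral_tendsto_integral
    (integrable_F ha hτ hτν hν hν0.le le_rfl hτν.ne') tendsto_neg_atTop_atBot tendsto_id
  have at0 : ∀ d : ℝ, 0 < d → Tendsto (fun R : ℝ => (Real.arctan (R / d) : ℂ)) atTop
      (𝓝 ((Real.pi / 2 : ℝ) : ℂ)) := by
    intro d hd
    exact (Complex.continuous_ofReal.tendsto _).comp
      ((tendsto_nhds_of_tendsto_nhdsWithin Real.tendsto_arctan_atTop).comp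
        (tendsto_id.atTop_div_const hd))
  have a1 := at0 (τ - 0) (by linarith)
  have a2 : Tendsto (fun R : ℝ => (Real.arctan (R / (τ - ν)) : ℂ)) atTop
      (𝓝 (-((Real.pi / 2 : ℝ) : ℂ))) := by
    refine (at0 (ν - τ) (by linarith)).neg.congr (fun R => ?_)
    rw [← neg_sub ν τ, div_neg, Real.arctan_neg, Complex.ofReal_neg]
  have hlim := (((i1.sub ((a1.const_mul (2 * I)).const_mul (h a ν τ (τ * I)))).sub
    (i2.sub ((a2.const_mul (2 * I)).const_mul (h a ν τ (τ * I))))).add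
    (s1.const_mul I)).sub (s2.const_mul I)
  have hz := tendsto_nhds_unique hlim (tendsto_const_nhds.congr (fun R => ?_) :
    Tendsto _ atTop (𝓝 (0 : ℂ)))
  · push_cast at hz ⊢
    linear_combination hz
  · have hrect := Complex.integral_boundary_rect_eq_zero_of_differentiableOn
      (dslope (h a ν τ) (τ * I)) ((-R : ℝ) : ℂ) ((R : ℂ) + ν * I) (by
        simpa using diff_G hτ hτν hν)
    have l1 := line_integral (R := R) ha hτ hτν hν le_rfl hν0.le hτ.ne
    have l2 := line_integral (R := R) ha hτ hτν hν hν0.le le_rfl hτν.ne'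
    have e1 : ((R : ℂ) + ν * I).re = R := by simp
    have e2 : ((R : ℂ) + ν * I).im = ν := by simp
    rw [e1, e2, Complex.ofReal_re, Complex.ofReal_im, l1, l2, smul_eq_mul, smul_eq_mul] at hrect
    exact hrect.symm

end Stmt3Aux

/-- when `τ < ν`, shifting the contour upward by `iν` crosses the simple pole
at `t = iτ`, picking up the residue `e^{-αω cos(ν-τ)}`. -/
theorem stmt3 (α ω ν τ : ℝ) (hα : 0 < α) (hω : 0 < ω)
    (hτ : 0 < τ) (hτν : τ < ν) (hν : ν < Real.pi / 2) :
    1 / (2 * (Real.pi : ℂ) * Complex.I) *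
        ∫ t : ℝ, Complex.exp (-(α * ω : ℝ) * Complex.cosh ((t : ℂ) - Complex.I * ν)) *
          Complex.sinh (t : ℂ) / (Complex.cosh (t : ℂ) - (Real.cos τ : ℂ)) =
      (Real.exp (-(α * ω) * Real.cos (ν - τ)) : ℂ) -
        1 / (2 * (Real.pi : ℂ) * Complex.I) *
          ∫ s : ℝ, Complex.exp (-(α * ω : ℝ) * Complex.cosh (s : ℂ)) *
            Complex.sinh ((s : ℂ) + Complex.I * ν) /
              ((Real.cos τ : ℂ) - Complex.cosh ((s : ℂ) + Complex.I * ν)) := by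
  have hmain := Stmt3Aux.main (a := α * ω) (mul_pos hα hω) hτ hτν hν
  rw [Stmt3Aux.h_tau hτ (by linarith [Real.pi_pos])] at hmain
  have e1 : (∫ t : ℝ, Complex.exp (-(α * ω : ℝ) * Complex.cosh ((t : ℂ) - Complex.I * ν)) *
      Complex.sinh (t : ℂ) / (Complex.cosh (t : ℂ) - (Real.cos τ : ℂ))) =
      ∫ x : ℝ, Stmt3Aux.F (α * ω) ν τ (x + (0 : ℝ) * Complex.I) := by
    simp only [Stmt3Aux.F, Complex.ofReal_zero, zero_mul, add_zero]
  have e2 : (∫ s : ℝ, Complex.exp (-(α * ω : ℝ) * Complex.cosh (s : ℂ)) *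
      Complex.sinh ((s : ℂ) + Complex.I * ν) /
        ((Real.cos τ : ℂ) - Complex.cosh ((s : ℂ) + Complex.I * ν))) =
      -∫ x : ℝ, Stmt3Aux.F (α * ω) ν τ (x + ν * Complex.I) := by
    rw [← MeasureTheory.integral_neg]
    congr 1
    funext x
    unfold Stmt3Aux.F
    rw [mul_comm (ν : ℂ) Complex.I, add_sub_cancel_right, ← div_neg, neg_sub]
  rw [e1, e2, sub_eq_iff_eq_add.1 hmain]
  have hpi : (Real.pi : ℂ) ≠ 0 := by exact_mod_cast Real.pi_ne_zero
  have hI := Complex.I_ne_zero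
  field_simp
  ring
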